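/- arXiv:quant-ph/9911078 — 2 statements merged into one kernel-verified Lean document; each statement's English description precedes it below -/
import Mathlib

section
/- Let B be a unital complex *-algebra and let θ₁, θ₋₁, θ₀ : B → B be linear maps such that: θ₁ and θ₋₁ are derivations (θ(ab) = θ(a)b + aθ(b) for all a, b ∈ B); θ₋₁(b*) = (θ₁(b))* and θ₀(b*) = (θ₀(b))* for all b ∈ B; and θ₀ satisfies the stochastic Leibniz rule θ₀(ab) = θ₀(a)b + aθ₀(b) + θ₋₁(a)θ₁(b) for all a, b ∈ B. Let E = [[0,0],[0,1]] ∈ M(2,B) and define L : M(2,B) → M(2,B) by L(x) = θ₀[x] + E·θ₁[x] + θ₋₁[x]·E, where θ[x] denotes entrywise application of θ to the matrix x. Then for every x ∈ M(2,B): L(x*x) = L(x*)·x + x*·L(x) + w*·w − [x,E]*·[x,E], where w = θ₁[x] + [x,E] and [x,E] = xE − Ex. -/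
/-- The Leibniz rule with a bilinear correction term passes to entrywise application on matrices. -/
theorem Matrix.map_mul_eq_of_leibniz {n B : Type*} [Fintype n] [Ring B] (θ φ ψ : B →+ B)
    (h : ∀ a b : B, θ (a * b) = θ a * b + a * θ b + φ a * ψ b) (x y : Matrix n n B) :
    (x * y).map ⇑θ = x.map ⇑θ * y + x * y.map ⇑θ + x.map ⇑φ * y.map ⇑ψ := by
  ext i j
  simp [Matrix.mul_apply, h, Finset.sum_add_distrib]

/-- Entrywise application of a derivation is a derivation on matrices. -/
theorem Matrix.map_mul_eq_of_derivation {n B : Type*} [Fintype n] [Ring B] (θ : B →+ B)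
    (h : ∀ a b : B, θ (a * b) = θ a * b + a * θ b) (x y : Matrix n n B) :
    (x * y).map ⇑θ = x.map ⇑θ * y + x * y.map ⇑θ := by
  ext i j
  simp [Matrix.mul_apply, h, Finset.sum_add_distrib]

/-- formula `(for_dissip)` in the proof of Lemma 22: for structure
maps `θ₁, θ₋₁, θ₀` on a unital complex *-algebra `B` (with `θ₁, θ₋₁` derivations,
`θ₋₁(b*) = θ₁(b)*`, `θ₀(b*) = θ₀(b)*`, and `θ₀` satisfying the stochastic Leibniz
rule), the generator `L(x) = θ₀[x] + E·θ₁[x] + θ₋₁[x]·E` on `M(2,B)` with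
`E = [[0,0],[0,1]]` satisfies
`L(x*x) = L(x*)·x + x*·L(x) + w*·w − [x,E]*·[x,E]` where `w = θ₁[x] + [x,E]`. -/
theorem stmt_10 {B : Type*} [Ring B] [Algebra ℂ B] [StarRing B]
    (θp θm θ0 : B →ₗ[ℂ] B)
    (hθp : ∀ a b : B, θp (a * b) = θp a * b + a * θp b)
    (hθm : ∀ a b : B, θm (a * b) = θm a * b + a * θm b)
    (hstar1 : ∀ b : B, θm (star b) = star (θp b))
    (hstar0 : ∀ b : B, θ0 (star b) = star (θ0 b))
    (hleib : ∀ a b : B, θ0 (a * b) = θ0 a * b + a * θ0 b + θm a * θp b) :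
    ∀ x : Matrix (Fin 2) (Fin 2) B,
      let E : Matrix (Fin 2) (Fin 2) B := !![0, 0; 0, 1]
      let L : Matrix (Fin 2) (Fin 2) B → Matrix (Fin 2) (Fin 2) B :=
        fun y => y.map ⇑θ0 + E * y.map ⇑θp + y.map ⇑θm * E
      let w : Matrix (Fin 2) (Fin 2) B := x.map ⇑θp + (x * E - E * x)
      L (star x * x) =
        L (star x) * x + star x * L x + star w * w -
          star (x * E - E * x) * (x * E - E * x) := by
  intro x E L w
  have hE : star E = E := by
    ext i j
    fin_cases i <;> fin_cases j <;> simp [E, Matrix.star_apply]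
  have h_star : star (x.map ⇑θp) = (star x).map ⇑θm := by
    ext i j
    simp [Matrix.star_apply, hstar1]
  have h_p : (star x * x).map ⇑θp = (star x).map ⇑θp * x + star x * x.map ⇑θp :=
    Matrix.map_mul_eq_of_derivation θp.toAddMonoidHom hθp _ _
  have h_m : (star x * x).map ⇑θm = (star x).map ⇑θm * x + star x * x.map ⇑θm :=
    Matrix.map_mul_eq_of_derivation θm.toAddMonoidHom hθm _ _
  have h_zero : (star x * x).map ⇑θ0 =
      (star x).map ⇑θ0 * x + star x * x.map ⇑θ0 + (star x).map ⇑θm * x.map ⇑θp :=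
    Matrix.map_mul_eq_of_leibniz θ0.toAddMonoidHom θm.toAddMonoidHom θp.toAddMonoidHom hleib _ _
  simp only [L, w, h_p, h_m, h_zero, star_add, star_sub, star_mul, hE, h_star]
  noncomm_ring
end

section
/- Let B be a unital complex *-algebra and let θ₁, θ₋₁, θ₀ : B → B be linear maps such that θ₁ and θ₋₁ are derivations, θ₋₁(b*) = (θ₁(b))*, θ₀(b*) = (θ₀(b))*, and θ₀(ab) = θ₀(a)b + aθ₀(b) + θ₋₁(a)θ₁(b) for all a, b ∈ B. Let E = [[0,0],[0,1]] ∈ M(2,B), define L : M(2,B) → M(2,B) by L(x) = θ₀[x] + E·θ₁[x] + θ₋₁[x]·E (θ applied entrywise), define δ : M(2,B) → M(2,B) by δ(x) = i·(xE − Ex), and set S = L + (1/2)·δ∘δ. Then for every x ∈ M(2,B): S(x*x) − S(x*)·x − x*·S(x) = w*·w, where w = θ₁[x] + [x,E]. In particular, in any ordering of M(2,B) in which elements of the form w*w are nonnegative, S(x*x) ≥ S(x*)x + x*S(x), i.e., S is a dissipation. -/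
theorem Matrix.map_mul_of_leibniz {n B : Type*} [Fintype n] [Ring B] [Algebra ℂ B]
    (θ : B →ₗ[ℂ] B) (hθ : ∀ a b : B, θ (a * b) = θ a * b + a * θ b) (x y : Matrix n n B) :
    (x * y).map ⇑θ = x.map ⇑θ * y + x * y.map ⇑θ := by
  ext i j
  simp [Matrix.mul_apply, hθ, Finset.sum_add_distrib]

theorem Matrix.map_mul_of_twisted_leibniz {n B : Type*} [Fintype n] [Ring B] [Algebra ℂ B]
    (θp θm θ0 : B →ₗ[ℂ] B)
    (h : ∀ a b : B, θ0 (a * b) = θ0 a * b + a * θ0 b + θm a * θp b) (x y : Matrix n n B) :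
    (x * y).map ⇑θ0 = x.map ⇑θ0 * y + x * y.map ⇑θ0 + x.map ⇑θm * y.map ⇑θp := by
  ext i j
  simp [Matrix.mul_apply, h, Finset.sum_add_distrib]

theorem half_smul_I_smul_commutator {A : Type*} [Ring A] [Module ℂ A] [IsScalarTower ℂ A A]
    [SMulCommClass ℂ A A] (e y : A) :
    (1 / 2 : ℂ) • (Complex.I • ((Complex.I • (y * e - e * y)) * e -
      e * (Complex.I • (y * e - e * y)))) =
      e * y * e - (1 / 2 : ℂ) • (y * (e * e) + e * e * y) := by
  have h : (y * e - e * y) * e - e * (y * e - e * y) =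
      (y * (e * e) + e * e * y) - (2 : ℂ) • (e * y * e) := by
    rw [two_smul]; noncomm_ring
  rw [smul_mul_assoc, mul_smul_comm, ← smul_sub, smul_smul Complex.I Complex.I,
    Complex.I_mul_I, h]
  module

theorem dissipation_identity {A : Type*} [Ring A] [Module ℂ A] [IsScalarTower ℂ A A]
    [SMulCommClass ℂ A A] (e x y x₀ y₀ xp yp xm ym : A) (he : e * e = e) :
    (y₀ * x + y * x₀ + ym * xp + e * (yp * x + y * xp) + (ym * x + y * xm) * e +
        (e * (y * x) * e - (1 / 2 : ℂ) • (y * x * e + e * (y * x)))) -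
      (y₀ + e * yp + ym * e + (e * y * e - (1 / 2 : ℂ) • (y * e + e * y))) * x -
      y * (x₀ + e * xp + xm * e + (e * x * e - (1 / 2 : ℂ) • (x * e + e * x))) =
      (ym + (e * y - y * e)) * (xp + (x * e - e * x)) := by
  have hhalf : (1 / 2 : ℂ) • (y * x * e + e * (y * x)) =
      (1 / 2 : ℂ) • (y * e + e * y) * x + y * (1 / 2 : ℂ) • (x * e + e * x) - y * e * x := by
    rw [smul_mul_assoc, mul_smul_comm, add_mul, mul_add]
    simp only [mul_assoc]
    module
  have hsq : y * e * x = y * e * (e * x) := by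
    rw [mul_assoc y e (e * x), ← mul_assoc e e x, he, mul_assoc]
  rw [hhalf, hsq]
  generalize (1 / 2 : ℂ) • (y * e + e * y) = q
  generalize (1 / 2 : ℂ) • (x * e + e * x) = r
  noncomm_ring

/-- formulas `(c4)`–`(c6)` in the proof of Lemma 22: with the
generator `L(x) = θ₀[x] + E·θ₁[x] + θ₋₁[x]·E` on `M(2,B)`, `E = [[0,0],[0,1]]`,
the derivation `δ(x) = i·[x,E]` and `S = L + ½ δ²`, one has
`S(x*x) − S(x*)·x − x*·S(x) = w*·w` where `w = θ₁[x] + [x,E]`; in particular `S` is a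
dissipation. -/
theorem stmt_12 {B : Type*} [Ring B] [Algebra ℂ B] [StarRing B]
    (θp θm θ0 : B →ₗ[ℂ] B)
    (hθp : ∀ a b : B, θp (a * b) = θp a * b + a * θp b)
    (hθm : ∀ a b : B, θm (a * b) = θm a * b + a * θm b)
    (hstar1 : ∀ b : B, θm (star b) = star (θp b))
    (hstar0 : ∀ b : B, θ0 (star b) = star (θ0 b))
    (hleib : ∀ a b : B, θ0 (a * b) = θ0 a * b + a * θ0 b + θm a * θp b) :
    ∀ x : Matrix (Fin 2) (Fin 2) B,
      let E : Matrix (Fin 2) (Fin 2) B := !![0, 0; 0, 1]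
      let L : Matrix (Fin 2) (Fin 2) B → Matrix (Fin 2) (Fin 2) B :=
        fun y => y.map ⇑θ0 + E * y.map ⇑θp + y.map ⇑θm * E
      let δ : Matrix (Fin 2) (Fin 2) B → Matrix (Fin 2) (Fin 2) B :=
        fun y => (Complex.I : ℂ) • (y * E - E * y)
      let S : Matrix (Fin 2) (Fin 2) B → Matrix (Fin 2) (Fin 2) B :=
        fun y => L y + (1 / 2 : ℂ) • δ (δ y)
      let w : Matrix (Fin 2) (Fin 2) B := x.map ⇑θp + (x * E - E * x)
      S (star x * x) - S (star x) * x - star x * S x = star w * w := by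
  intro x E L δ S w
  have hE : E * E = E := by
    ext i j
    fin_cases i <;> fin_cases j <;> simp [E, Matrix.mul_apply]
  have hEs : star E = E := by
    ext i j
    fin_cases i <;> fin_cases j <;> simp [E, Matrix.star_apply]
  have hS : ∀ y, S y = y.map ⇑θ0 + E * y.map ⇑θp + y.map ⇑θm * E +
      (E * y * E - (1 / 2 : ℂ) • (y * E + E * y)) := by
    intro y
    have h := half_smul_I_smul_commutator E y
    rw [hE] at h
    simp only [S, L, δ, h]
  have hw : star w = (star x).map ⇑θm + (E * star x - star x * E) := by
    have h : star (x.map ⇑θp) = (star x).map ⇑θm := by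
      ext i j
      simp [Matrix.star_apply, hstar1]
    simp only [w, star_add, star_sub, star_mul, hEs, h]
  rw [hw, hS, hS, hS, Matrix.map_mul_of_leibniz θp hθp, Matrix.map_mul_of_leibniz θm hθm,
    Matrix.map_mul_of_twisted_leibniz θp θm θ0 hleib]
  exact dissipation_identity E x (star x) _ _ _ _ _ _ hE
end
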